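/- Let 𝒞 be a category, let C : finCard_s → 𝒞 be a functor, and for each n ∈ ℕ let d^n : C(n) → C(n+1) be a morphism of 𝒞 such that, writing ε^n_i for C(ε^n_i) and σ^n_i for C(σ^n_i), the following hold for all applicable indices (diagrammatic composition): d^n;ε^n_1 = 1; d^{n+1};ε^{n+1}_{j+1} = ε^n_j;d^n (1 ≤ j ≤ n); d^n;d^{n+1};σ^{n+2}_1 = d^n;d^{n+1}; and d^n;σ^{n+1}_{i+1} = σ^n_i;d^n (1 ≤ i ≤ n−1). Then there is a unique functor C' : finCard → 𝒞 whose restriction along the inclusion finCard_s ↪ finCard equals C and which satisfies C'(δ^n_1) = d^n for all n. Moreover, C'(δ^n_i) = d^n;C(σ^{n+1}_{(i)}) for all 1 ≤ i ≤ n+1. -/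

import Mathlib

open CategoryTheory

/-- The category of finite cardinals: objects are natural numbers, morphisms `n ⟶ m` are
all functions `Fin n → Fin m` (composition is diagrammatic). -/
structure FinCard : Type where
  len : ℕ

instance : Category FinCard where
  Hom n m := Fin n.len → Fin m.len
  id _ := _root_.id
  comp f g := g ∘ f
  id_comp _ := rfl
  comp_id _ := rfl
  assoc _ _ _ := rfl

def FinCard.of (n : ℕ) : FinCard := ⟨n⟩

/-- The wide subcategory of finite cardinals and surjections. -/
structure FinCardS : Type where
  len : ℕ

instance : Category FinCardS where
  Hom n m := {f : Fin n.len → Fin m.len // Function.Surjective f}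
  id _ := ⟨_root_.id, Function.surjective_id⟩
  comp f g := ⟨g.1 ∘ f.1, g.2.comp f.2⟩
  id_comp _ := rfl
  comp_id _ := rfl
  assoc _ _ _ := rfl

def FinCardS.of (n : ℕ) : FinCardS := ⟨n⟩

/-- The inclusion `finCard_s ↪ finCard`. -/
def inclSF : FinCardS ⥤ FinCard where
  obj n := ⟨n.len⟩
  map f := f.1
  map_id _ := rfl
  map_comp _ _ := rfl

/-- The codegeneracy function `ε^n_i : [n+1] → [n]` (1-based: `x ↦ x` if `x ≤ i`,
`x ↦ x−1` if `x > i`), written 0-based on `Fin`. Requires `1 ≤ i ≤ n`. -/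
def epsF (n i : ℕ) (h1 : 1 ≤ i) (h2 : i ≤ n) : Fin (n + 1) → Fin n := fun x =>
  if h : x.val < i then ⟨x.val, by omega⟩
  else ⟨x.val - 1, by have := x.isLt; omega⟩

lemma epsF_surj (n i : ℕ) (h1 : 1 ≤ i) (h2 : i ≤ n) :
    Function.Surjective (epsF n i h1 h2) := by
  intro y
  by_cases hy : y.val < i
  · exact ⟨⟨y.val, by omega⟩, by simp [epsF, hy]⟩
  · refine ⟨⟨y.val + 1, by have := y.isLt; omega⟩, ?_⟩
    simp only [epsF]
    rw [dif_neg (by omega)]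
    apply Fin.ext
    simp

/-- The codegeneracy `ε^n_i` as a morphism of `FinCardS`. -/
def epsHomS (n i : ℕ) (h1 : 1 ≤ i) (h2 : i ≤ n) : FinCardS.of (n + 1) ⟶ FinCardS.of n :=
  ⟨epsF n i h1 h2, epsF_surj n i h1 h2⟩

/-- The symmetry `σ^n_i : [n] → [n]` (the transposition exchanging `i` and `i+1`, 1-based)
as a morphism of `FinCardS`.  Requires `1 ≤ i ≤ n−1`. -/
def sigmaHomS (n i : ℕ) (h1 : 1 ≤ i) (h2 : i + 1 ≤ n) : FinCardS.of n ⟶ FinCardS.of n :=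
  ⟨⇑(Equiv.swap (⟨i - 1, by omega⟩ : Fin n) ⟨i, by omega⟩), (Equiv.swap _ _).surjective⟩

/-- The cycle function `σ^n_{(i)} = (i (i−1) ⋯ 3 2 1) : [n] → [n]` (1-based: `1 ↦ i`,
`x ↦ x−1` for `2 ≤ x ≤ i`, `x ↦ x` for `x > i`), written 0-based on `Fin`.
Requires `1 ≤ i ≤ n`. -/
def sigmaCycleF (n i : ℕ) (h1 : 1 ≤ i) (h2 : i ≤ n) : Fin n → Fin n := fun x =>
  if x.val = 0 then ⟨i - 1, by omega⟩
  else if h : x.val < i then ⟨x.val - 1, by have := x.isLt; omega⟩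
  else x

lemma sigmaCycleF_surj (n i : ℕ) (h1 : 1 ≤ i) (h2 : i ≤ n) :
    Function.Surjective (sigmaCycleF n i h1 h2) := by
  intro y
  by_cases hy : y.val + 1 < i
  · refine ⟨⟨y.val + 1, by omega⟩, ?_⟩
    simp only [sigmaCycleF]
    rw [if_neg (by omega), dif_pos (by omega)]
    apply Fin.ext; simp
  · by_cases hy2 : y.val = i - 1
    · refine ⟨⟨0, by omega⟩, ?_⟩
      simp only [sigmaCycleF]
      rw [if_pos trivial]
      apply Fin.ext
      simp [hy2]
    · refine ⟨y, ?_⟩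
      simp only [sigmaCycleF]
      rw [if_neg (by omega), dif_neg (by omega)]

/-- The cycle `σ^n_{(i)}` as a morphism of `FinCardS`. -/
def sigmaCycleHomS (n i : ℕ) (h1 : 1 ≤ i) (h2 : i ≤ n) : FinCardS.of n ⟶ FinCardS.of n :=
  ⟨sigmaCycleF n i h1 h2, sigmaCycleF_surj n i h1 h2⟩

/-- The coface `δ^n_i : [n] → [n+1]` (1-based: `x ↦ x` if `x < i`, `x ↦ x+1` if `x ≥ i`),
as a morphism of `FinCard`; `deltaHom n 1` is the fundamental coface `δ^n_1`. -/
def deltaHom (n i : ℕ) : FinCard.of n ⟶ FinCard.of (n + 1) :=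
  show Fin n → Fin (n + 1) from fun x =>
    if x.val + 1 < i then ⟨x.val, by have := x.isLt; omega⟩
    else ⟨x.val + 1, by have := x.isLt; omega⟩

namespace FinCardS

/-- A surjective function between standard finite sets, as a morphism of `FinCardS`. -/
def ofSurj {a b : ℕ} (f : Fin a → Fin b) (hf : Function.Surjective f) : of a ⟶ of b := ⟨f, hf⟩

lemma hom_ext {a b : ℕ} {f g : of a ⟶ of b} (h : ∀ x, f.1 x = g.1 x) : f = g :=
  Subtype.ext (funext h)

/-- The function `1 + f`, fixing `0` and acting as `f` on successors. -/
def shiftFun {a b : ℕ} (f : Fin a → Fin b) : Fin (a + 1) → Fin (b + 1) :=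
  Fin.cons 0 (Fin.succ ∘ f)

lemma shiftFun_surjective {a b : ℕ} {f : Fin a → Fin b} (hf : Function.Surjective f) :
    Function.Surjective (shiftFun f) := by
  intro y
  induction y using Fin.cases with
  | zero => exact ⟨0, rfl⟩
  | succ y =>
    obtain ⟨x, rfl⟩ := hf y
    exact ⟨x.succ, rfl⟩

/-- The morphism `1 + s` of `FinCardS`. -/
def shift {a b : ℕ} (s : of a ⟶ of b) : of (a + 1) ⟶ of (b + 1) :=
  ofSurj (shiftFun s.1) (shiftFun_surjective s.2)

lemma shift_comp {a b c : ℕ} (s : of a ⟶ of b) (t : of b ⟶ of c) :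
    shift (s ≫ t) = shift s ≫ shift t := by
  refine hom_ext fun x => ?_
  refine Fin.cases ?_ (fun x => ?_) x <;> rfl

lemma shift_id (a : ℕ) : shift (𝟙 (of a)) = 𝟙 (of (a + 1)) := by
  refine hom_ext fun x => ?_
  refine Fin.cases ?_ (fun x => ?_) x <;> rfl

/-- A permutation as a morphism of `FinCardS`. -/
def ofPerm {a : ℕ} (π : Equiv.Perm (Fin a)) : of a ⟶ of a := ofSurj π π.surjective

/-- Every surjection between finite cardinals is a composite of adjacent transpositions and
first codegeneracies. -/
lemma surj_induction (P : ∀ {a b : ℕ}, (of a ⟶ of b) → Prop)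
    (id : ∀ a, P (𝟙 (of a)))
    (comp : ∀ {a b c : ℕ} (s : of a ⟶ of b) (t : of b ⟶ of c), P s → P t → P (s ≫ t))
    (swap : ∀ (n i : ℕ) (h1 : 1 ≤ i) (h2 : i + 1 ≤ n), P (sigmaHomS n i h1 h2))
    (eps : ∀ (n : ℕ) (hn : 1 ≤ n), P (epsHomS n 1 le_rfl hn))
    {a b : ℕ} (s : of a ⟶ of b) : P s := by
  have perm : ∀ {a : ℕ} (π : Equiv.Perm (Fin a)), P (ofPerm π) := by
    intro a π
    cases a with
    | zero =>
      have : ofPerm π = 𝟙 (of 0) := hom_ext fun x => x.elim0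
      rw [this]; exact id 0
    | succ a =>
      have hπ : π ∈ Submonoid.closure
          (Set.range fun i : Fin a => Equiv.swap i.castSucc i.succ) := by
        rw [Equiv.Perm.mclosure_swap_castSucc_succ]; trivial
      induction hπ using Submonoid.closure_induction with
      | mem x hx =>
        obtain ⟨i, rfl⟩ := hx
        exact swap (a + 1) (i + 1) (by omega) (by omega)
      | one => exact id _
      | mul x y _ _ hx hy => exact comp (ofPerm y) (ofPerm x) hy hx
  induction a with
  | zero =>
    obtain rfl : b = 0 := by
      cases b with
      | zero => rfl
      | succ b => exact (s.2 (0 : Fin (b + 1))).choose.elim0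
    have : s = 𝟙 (of 0) := hom_ext fun x => x.elim0
    rw [this]; exact id 0
  | succ a ih =>
    by_cases hs : Function.Injective s.1
    · have hab : a + 1 = b := by
        have := Fintype.card_of_bijective (α := Fin (a + 1)) (β := Fin b) ⟨hs, s.2⟩
        rwa [Fintype.card_fin, Fintype.card_fin] at this
      subst hab
      exact perm (Equiv.ofBijective s.1 ⟨hs, s.2⟩)
    · simp only [Function.Injective, not_forall] at hs
      obtain ⟨x, y, hxy, hne⟩ := hs
      change Fin (a + 1) at x y
      obtain ⟨a, rfl⟩ : ∃ c, a = c + 1 := by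
        cases a with
        | zero => exact absurd (Subsingleton.elim (α := Fin 1) x y) hne
        | succ a => exact ⟨a, rfl⟩
      obtain ⟨π, h0, h1⟩ : ∃ π : Equiv.Perm (Fin (a + 2)), π 0 = x ∧ π 1 = y := by
        have hz : Equiv.swap 0 x y ≠ 0 := by
          rw [Ne, Equiv.swap_apply_eq_iff, Equiv.swap_apply_left]
          exact fun h => hne h.symm
        refine ⟨Equiv.swap 0 x * Equiv.swap 1 (Equiv.swap 0 x y), ?_, ?_⟩
        · rw [Equiv.Perm.mul_apply, Equiv.swap_apply_of_ne_of_ne (by simp) hz.symm,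
            Equiv.swap_apply_left]
        · rw [Equiv.Perm.mul_apply, Equiv.swap_apply_left, Equiv.swap_apply_self]
      have hfac : ∀ z : Fin (a + 2),
          s.1 (π (Fin.succ (epsF (a + 1) 1 le_rfl (by omega) z))) = s.1 (π z) := by
        intro z
        induction z using Fin.cases with
        | zero =>
          have : Fin.succ (epsF (a + 1) 1 le_rfl (by omega) 0) = 1 := rfl
          rw [this, h0, h1]; exact hxy.symm
        | succ z =>
          rfl
      let t : of (a + 1) ⟶ of b := ofSurj (fun z => s.1 (π z.succ)) fun w => by
        obtain ⟨z, rfl⟩ := s.2 w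
        exact ⟨epsF (a + 1) 1 le_rfl (by omega) (π.symm z),
          (hfac (π.symm z)).trans (congrArg s.1 (π.apply_symm_apply z))⟩
      have : s = ofPerm π.symm ≫ epsHomS (a + 1) 1 le_rfl (by omega) ≫ t := by
        refine hom_ext fun z => ?_
        exact ((hfac (π.symm z)).trans (congrArg s.1 (π.apply_symm_apply z))).symm
      rw [this]
      exact comp _ _ (perm _) (comp _ _ (eps _ _) (ih t))

/-- Extend `f : Fin n → Fin m` by the values in `l`, placed before those of `f`. -/
def extend {n m : ℕ} (f : Fin n → Fin m) : ∀ l : List (Fin m), Fin (n + l.length) → Fin m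
  | [] => f
  | x :: l => Fin.cons (α := fun _ => Fin m) x (extend f l)

lemma extend_surjective_of_forall_mem {n m : ℕ} (f : Fin n → Fin m) (l : List (Fin m))
    (h : ∀ x, x ∈ l) : Function.Surjective (extend f l) := by
  have key : ∀ (l : List (Fin m)), ∀ x ∈ l, ∃ z, extend f l z = x := by
    intro l
    induction l with
    | nil => simp
    | cons y l ih =>
      intro x hx
      rcases List.mem_cons.1 hx with rfl | hx
      · exact ⟨(0 : Fin (n + l.length + 1)), rfl⟩
      · obtain ⟨z, rfl⟩ := ih x hx
        exact ⟨Fin.succ z, rfl⟩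
  exact fun x => key l x (h x)

lemma extend_append_surjective {n m : ℕ} (f : Fin n → Fin m) (l l' : List (Fin m))
    (h : Function.Surjective (extend f l)) : Function.Surjective (extend f (l' ++ l)) := by
  induction l' with
  | nil => exact h
  | cons y l' ih =>
    intro x
    obtain ⟨z, rfl⟩ := ih x
    exact ⟨Fin.succ z, rfl⟩

lemma exists_extend_eq {n m : ℕ} (k : ℕ) (g : Fin (n + k) → Fin m) :
    ∃ (l : List (Fin m)) (hl : l.length = k),
      ∀ x, g x = extend (fun y => g (y.addNat k)) l (Fin.cast (by rw [hl]) x) := by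
  induction k with
  | zero => exact ⟨[], rfl, fun x => rfl⟩
  | succ k ih =>
    obtain ⟨l, rfl, hl⟩ := ih (g ∘ Fin.succ)
    refine ⟨g (0 : Fin (n + l.length + 1)) :: l, rfl, fun x => ?_⟩
    induction x using Fin.cases (n := n + l.length) with
    | zero => rfl
    | succ x => exact hl x

lemma extend_addNat {n m : ℕ} (f : Fin n → Fin m) (l : List (Fin m)) (y : Fin n) :
    extend f l (y.addNat l.length) = f y := by
  induction l with
  | nil => rfl
  | cons x l ih => exact ih

end FinCardS

namespace CofaceExtension

open FinCardS

variable {𝒞 : Type*} [Category 𝒞] {C : FinCardS ⥤ 𝒞}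
  (d : ∀ n : ℕ, C.obj (FinCardS.of n) ⟶ C.obj (FinCardS.of (n + 1)))

/-- The fundamental coface relations, in terms of arbitrary surjections. -/
structure Relations : Prop where
  naturality {a b : ℕ} (s : of a ⟶ of b) : d a ≫ C.map (shift s) = C.map s ≫ d b
  eps (n : ℕ) (hn : 1 ≤ n) : d n ≫ C.map (epsHomS n 1 le_rfl hn) = 𝟙 _
  sigma (n : ℕ) :
    d n ≫ d (n + 1) ≫ C.map (sigmaHomS (n + 2) 1 le_rfl (Nat.le_add_left 2 n)) = d n ≫ d (n + 1)

/-- Iterated fundamental coface. -/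
def iter (n : ℕ) : ∀ k : ℕ, C.obj (of n) ⟶ C.obj (of (n + k))
  | 0 => 𝟙 _
  | k + 1 => iter n k ≫ d (n + k)

variable {d}

lemma Relations.comp_cons (R : Relations d) {n m : ℕ} (s : of n ⟶ of m) (x : Fin m)
    (hs : Function.Surjective (Fin.cons x s.1 : Fin (n + 1) → Fin m)) :
    d n ≫ C.map (ofSurj (Fin.cons x s.1 : Fin (n + 1) → Fin m) hs) = C.map s := by
  obtain ⟨y, rfl⟩ := s.2 x
  change Fin n at y
  obtain ⟨n, rfl⟩ : ∃ k, n = k + 1 := ⟨n - 1, by have := y.isLt; omega⟩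
  have h : ofSurj (Fin.cons (s.1 y) s.1 : Fin (n + 2) → Fin m) hs =
      shift (ofPerm (Equiv.swap 0 y)) ≫ epsHomS (n + 1) 1 le_rfl (by omega) ≫
        ofPerm (Equiv.swap 0 y) ≫ s := by
    refine hom_ext fun z => ?_
    induction z using Fin.cases with
    | zero =>
      change s.1 y = s.1 (Equiv.swap 0 y 0)
      rw [Equiv.swap_apply_left]
    | succ z =>
      change s.1 z = s.1 (Equiv.swap 0 y (Equiv.swap 0 y z))
      rw [Equiv.swap_apply_self]
  have h2 : ofPerm (Equiv.swap 0 y) ≫ ofPerm (Equiv.swap 0 y) = 𝟙 (of (n + 1)) :=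
    hom_ext fun z => Equiv.swap_apply_self 0 y z
  rw [h, C.map_comp, ← Category.assoc, R.naturality, C.map_comp, Category.assoc,
    reassoc_of% (R.eps (n + 1) (by omega)), ← C.map_comp, reassoc_of% h2]

lemma Relations.exists_of_perm (R : Relations d) {n m : ℕ} (f : Fin n → Fin m)
    {l l' : List (Fin m)} (h : l.Perm l') :
    ∃ p : of (n + l.length) ⟶ of (n + l'.length),
      iter d n l.length ≫ C.map p = iter d n l'.length ∧
        ∀ x, extend f l' (p.1 x) = extend f l x := by
  induction h with
  | nil => exact ⟨𝟙 _, by simp, fun _ => rfl⟩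
  | @cons x l l' _ ih =>
    obtain ⟨p, hp, hf⟩ := ih
    refine ⟨shift p, ?_, fun z => ?_⟩
    · change (iter d n l.length ≫ d _) ≫ C.map (shift p) = iter d n l'.length ≫ d _
      rw [Category.assoc, R.naturality, reassoc_of% hp]
    · induction z using Fin.cases (n := n + l.length) with
      | zero => rfl
      | succ z => exact hf z
  | swap x y l =>
    refine ⟨sigmaHomS (n + l.length + 2) 1 le_rfl (Nat.le_add_left 2 _), ?_, fun z => ?_⟩
    · change ((iter d n l.length ≫ d _) ≫ d _) ≫ _ = (iter d n l.length ≫ d _) ≫ d _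
      simp only [Category.assoc]
      exact congrArg (iter d n l.length ≫ ·) (R.sigma (n + l.length))
    · change extend f (x :: y :: l) (Equiv.swap (0 : Fin (n + l.length + 2)) 1 z) = _
      induction z using Fin.cases (n := n + l.length + 1) with
      | zero => rw [Equiv.swap_apply_left]; rfl
      | succ z =>
        induction z using Fin.cases (n := n + l.length) with
        | zero =>
          change extend f (x :: y :: l) (Equiv.swap (0 : Fin (n + l.length + 2)) 1 1) = _
          rw [Equiv.swap_apply_right]; rfl
        | succ z =>
          rw [Equiv.swap_apply_of_ne_of_ne (b := (1 : Fin (n + l.length + 2)))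
            (Fin.succ_ne_zero _) (fun h => Fin.succ_ne_zero z (Fin.succ_injective _ h))]
          rfl
  | trans _ _ ih ih' =>
    obtain ⟨p, hp, hf⟩ := ih
    obtain ⟨q, hq, hg⟩ := ih'
    exact ⟨p ≫ q, by rw [C.map_comp, reassoc_of% hp, hq],
      fun x => (hg (p.1 x)).trans (hf x)⟩

variable (d) in
/-- The value on `f` computed from the extension of `f` to a surjection by the list `l`. -/
def value {n m : ℕ} (f : Fin n → Fin m) (l : List (Fin m))
    (h : Function.Surjective (extend f l)) : C.obj (of n) ⟶ C.obj (of m) :=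
  iter d n l.length ≫ C.map (ofSurj (extend f l) h)

lemma Relations.value_append (R : Relations d) {n m : ℕ} (f : Fin n → Fin m)
    (l l' : List (Fin m)) (h : Function.Surjective (extend f l)) :
    value d f (l' ++ l) (extend_append_surjective f l l' h) = value d f l h := by
  induction l' with
  | nil => rfl
  | cons x l' ih =>
    rw [← ih]
    change (iter d n (l' ++ l).length ≫ d _) ≫ _ = _
    rw [Category.assoc]
    exact congrArg (iter d n (l' ++ l).length ≫ ·)
      (R.comp_cons (ofSurj _ (extend_append_surjective f l l' h)) x _)

lemma Relations.value_perm (R : Relations d) {n m : ℕ} (f : Fin n → Fin m)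
    {l l' : List (Fin m)} (hl : l.Perm l') (h : Function.Surjective (extend f l))
    (h' : Function.Surjective (extend f l')) : value d f l h = value d f l' h' := by
  obtain ⟨p, hp, hf⟩ := R.exists_of_perm f hl
  have : ofSurj _ h = p ≫ ofSurj _ h' := hom_ext fun x => (hf x).symm
  rw [value, value, this, C.map_comp, reassoc_of% hp]

lemma Relations.value_eq (R : Relations d) {n m : ℕ} (f : Fin n → Fin m)
    (l l' : List (Fin m)) (h : Function.Surjective (extend f l))
    (h' : Function.Surjective (extend f l')) : value d f l h = value d f l' h' := by
  rw [← R.value_append f l l' h, ← R.value_append f l' l h']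
  exact R.value_perm f List.perm_append_comm _ _

variable (d) in
/-- The action of the extended functor on morphisms. -/
def map {n m : ℕ} (f : Fin n → Fin m) : C.obj (of n) ⟶ C.obj (of m) :=
  value d f (List.finRange m) (extend_surjective_of_forall_mem f _ List.mem_finRange)

lemma Relations.iter_comp_map (R : Relations d) {n m k : ℕ} (g : of (n + k) ⟶ of m) :
    iter d n k ≫ C.map g = map d (fun y => g.1 (Fin.addNat y k)) := by
  obtain ⟨l, rfl, hl⟩ := exists_extend_eq k g.1
  have hg : Function.Surjective (extend (fun y => g.1 (Fin.addNat y l.length)) l) := by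
    intro x
    obtain ⟨z, rfl⟩ := g.2 x
    exact ⟨z, (hl z).symm⟩
  have : g = ofSurj _ hg := hom_ext hl
  refine Eq.trans ?_ (R.value_eq _ l _ hg _)
  exact congrArg (iter d n l.length ≫ C.map ·) this

lemma Relations.map_surj (R : Relations d) {n m : ℕ} (s : of n ⟶ of m) :
    map d s.1 = C.map s := by
  have := R.iter_comp_map (k := 0) s
  rw [iter, Category.id_comp] at this
  exact this.symm

lemma Relations.map_succ (R : Relations d) (n : ℕ) : map d (Fin.succ : Fin n → _) = d n := by
  have := R.iter_comp_map (n := n) (k := 1) (𝟙 (of (n + 1)))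
  rw [C.map_id, Category.comp_id, iter, iter, Category.id_comp] at this
  exact this.symm

lemma Relations.map_comp_surj (R : Relations d) {n m k : ℕ} (f : Fin n → Fin m)
    (s : of m ⟶ of k) : map d f ≫ C.map s = map d (s.1 ∘ f) := by
  rw [map, value, Category.assoc, ← C.map_comp, R.iter_comp_map]
  congr 1
  funext y
  exact congrArg s.1 (extend_addNat f _ y)

lemma Relations.map_comp_d (R : Relations d) {n m : ℕ} (f : Fin n → Fin m) :
    map d f ≫ d m = map d (Fin.succ ∘ f) := by
  rw [map, value, Category.assoc, ← R.naturality, ← Category.assoc]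
  refine (R.iter_comp_map (k := (List.finRange m).length + 1) _).trans ?_
  congr 1
  funext y
  exact congrArg Fin.succ (extend_addNat f _ y)

lemma Relations.map_comp_iter (R : Relations d) {n m : ℕ} (f : Fin n → Fin m) (k : ℕ) :
    map d f ≫ iter d m k = map d (fun y => (f y).addNat k) := by
  induction k with
  | zero => exact Category.comp_id _
  | succ k ih =>
    rw [iter, ← Category.assoc, ih, R.map_comp_d]
    rfl

lemma Relations.map_comp (R : Relations d) {n m k : ℕ} (f : Fin n → Fin m)
    (g : Fin m → Fin k) : map d f ≫ map d g = map d (g ∘ f) := by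
  conv_lhs => rw [map.eq_def d g, value, ← Category.assoc, R.map_comp_iter, R.map_comp_surj]
  congr 1
  funext y
  exact extend_addNat g _ (f y)

/-- The extension of `C` to all functions between finite cardinals. -/
def Relations.functor (R : Relations d) : FinCard ⥤ 𝒞 where
  obj n := C.obj (of n.len)
  map f := map d f
  map_id n := (R.map_surj (𝟙 (of n.len))).trans (C.map_id _)
  map_comp f g := (R.map_comp f g).symm

lemma Relations.inclSF_comp_functor (R : Relations d) : inclSF ⋙ R.functor = C :=
  CategoryTheory.Functor.ext (fun _ => rfl) fun _ _ s =>
    (R.map_surj s).trans ((Category.id_comp _).trans (Category.comp_id _)).symm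

lemma deltaHom_one (n : ℕ) : deltaHom n 1 = (Fin.succ : Fin n → Fin (n + 1)) := by
  rfl

lemma deltaHom_eq_comp (n i : ℕ) (h1 : 1 ≤ i) (h2 : i ≤ n + 1) :
    deltaHom n i = deltaHom n 1 ≫ inclSF.map (sigmaCycleHomS (n + 1) i h1 h2) := by
  rw [deltaHom_one]
  funext x
  change Fin n at x
  change _ = sigmaCycleF (n + 1) i h1 h2 x.succ
  by_cases h : x.val + 1 < i <;> simp [deltaHom, sigmaCycleF, h, Fin.ext_iff]

lemma Relations.eq_functor (C' : FinCard ⥤ 𝒞)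
    {d : ∀ n : ℕ, (inclSF ⋙ C').obj (of n) ⟶ (inclSF ⋙ C').obj (of (n + 1))}
    (R : Relations d) (hd : ∀ n, C'.map (deltaHom n 1) = d n) : C' = R.functor := by
  refine CategoryTheory.Functor.ext (fun _ => rfl) fun n m f => ?_
  have hiter : ∀ n k : ℕ, iter d n k =
      C'.map (X := FinCard.of n) (Y := FinCard.of (n + k)) (fun y : Fin n => y.addNat k) := by
    intro n k
    induction k with
    | zero => exact (C'.map_id (FinCard.of n)).symm
    | succ k ih =>
      rw [iter, ih, ← hd, deltaHom_one]
      exact (C'.map_comp _ _).symm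
  refine Eq.trans ?_ ((Category.id_comp _).trans (Category.comp_id _)).symm
  change _ = iter d n.len _ ≫ C'.map _
  rw [hiter]
  refine Eq.trans ?_ (C'.map_comp _ _)
  congr 1
  funext y
  exact (extend_addNat f _ y).symm

end CofaceExtension

open CofaceExtension in
/-- STATEMENT 7: a symmetric codegenerative object `C : finCard_s ⥤ 𝒞` together with
fundamental coface data `d^n : C(n) ⟶ C(n+1)` satisfying the fundamental coface relations
extends uniquely to a symmetric cosimplicial object `C' : finCard ⥤ 𝒞` with
`C'(δ^n_1) = d^n`; moreover `C'(δ^n_i) = d^n ; C(σ^{n+1}_{(i)})` for `1 ≤ i ≤ n+1`. -/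
theorem unique_extension_along_fundamental_cofaces
    (𝒞 : Type*) [Category 𝒞] (C : FinCardS ⥤ 𝒞)
    (d : ∀ n : ℕ, C.obj (FinCardS.of n) ⟶ C.obj (FinCardS.of (n + 1)))
    -- d^n ; ε^n_1 = 1    (for n ≥ 1)
    (hde1 : ∀ (n : ℕ) (hn : 1 ≤ n),
      d n ≫ C.map (epsHomS n 1 le_rfl hn) = 𝟙 (C.obj (FinCardS.of n)))
    -- d^{n+1} ; ε^{n+1}_{j+1} = ε^n_j ; d^n    (1 ≤ j ≤ n)
    (hde2 : ∀ (n j : ℕ) (h1 : 1 ≤ j) (h2 : j ≤ n),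
      d (n + 1) ≫ C.map (epsHomS (n + 1) (j + 1) (by omega) (by omega))
        = C.map (epsHomS n j h1 h2) ≫ d n)
    -- d^n ; d^{n+1} ; σ^{n+2}_1 = d^n ; d^{n+1}
    (hds1 : ∀ n : ℕ,
      d n ≫ d (n + 1) ≫ C.map (sigmaHomS (n + 2) 1 (by omega) (by omega))
        = d n ≫ d (n + 1))
    -- d^n ; σ^{n+1}_{i+1} = σ^n_i ; d^n    (1 ≤ i ≤ n−1)
    (hds2 : ∀ (n i : ℕ) (h1 : 1 ≤ i) (h2 : i + 1 ≤ n),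
      d n ≫ C.map (sigmaHomS (n + 1) (i + 1) (by omega) (by omega))
        = C.map (sigmaHomS n i h1 h2) ≫ d n) :
    (∃! C' : FinCard ⥤ 𝒞,
      ∃ h : inclSF ⋙ C' = C,
        ∀ n : ℕ, C'.map (deltaHom n 1)
          = eqToHom (Functor.congr_obj h (FinCardS.of n)) ≫ d n
              ≫ eqToHom (Functor.congr_obj h (FinCardS.of (n + 1))).symm) ∧
    (∀ C' : FinCard ⥤ 𝒞,
      (∃ h : inclSF ⋙ C' = C,
        ∀ n : ℕ, C'.map (deltaHom n 1)
          = eqToHom (Functor.congr_obj h (FinCardS.of n)) ≫ d n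
              ≫ eqToHom (Functor.congr_obj h (FinCardS.of (n + 1))).symm) →
      ∀ (h : inclSF ⋙ C' = C) (n i : ℕ) (h1 : 1 ≤ i) (h2 : i ≤ n + 1),
        C'.map (deltaHom n i)
          = eqToHom (Functor.congr_obj h (FinCardS.of n))
              ≫ (d n ≫ C.map (sigmaCycleHomS (n + 1) i h1 h2))
              ≫ eqToHom (Functor.congr_obj h (FinCardS.of (n + 1))).symm) := by
  have R : Relations d :=
    { naturality := fun s => by
        refine FinCardS.surj_induction
          (fun {a b} s => d a ≫ C.map (FinCardS.shift s) = C.map s ≫ d b) ?_ ?_ ?_ ?_ s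
        · intro a
          simp [FinCardS.shift_id]
        · intro a b c s t hs ht
          rw [FinCardS.shift_comp, C.map_comp, C.map_comp, reassoc_of% hs, ht, Category.assoc]
        · intro n i h1 h2
          rw [← hds2]
          congr 2
          refine FinCardS.hom_ext fun x => ?_
          obtain ⟨i, rfl⟩ : ∃ k, i = k + 1 := ⟨i - 1, by omega⟩
          induction x using Fin.cases (n := n) with
          | zero =>
            exact (Equiv.swap_apply_of_ne_of_ne (a := (⟨i + 1, by omega⟩ : Fin (n + 1)))
              (b := ⟨i + 2, by omega⟩) (x := 0) (by simp [Fin.ext_iff])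
              (by simp [Fin.ext_iff])).symm
          | succ x =>
            exact ((Fin.succ_injective n).swap_apply ⟨i, by omega⟩ ⟨i + 1, by omega⟩ x).symm
        · intro n hn
          rw [← hde2]
          congr 2
          refine FinCardS.hom_ext fun x => ?_
          induction x using Fin.cases (n := n + 1) with
          | zero => rfl
          | succ x =>
            change Fin.succ (epsF n 1 le_rfl hn x) = epsF (n + 1) 2 (by omega) (by omega) x.succ
            apply Fin.ext
            simp only [epsF, Fin.val_succ]
            split_ifs <;> simp only <;> omega
      eps := hde1
      sigma := hds1 }
  refine ⟨⟨R.functor, ⟨R.inclSF_comp_functor, fun n => ?_⟩, ?_⟩, ?_⟩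
  · refine Eq.trans ?_ ((Category.id_comp _).trans (Category.comp_id _)).symm
    exact R.map_succ n
  · rintro C' ⟨rfl, hd⟩
    exact R.eq_functor C' fun n => by simpa using hd n
  · rintro C' ⟨_, hd⟩ rfl n i h1 h2
    have hd' : C'.map (deltaHom n 1) = d n := by simpa using hd n
    simp only [eqToHom_refl, Category.id_comp, Category.comp_id]
    rw [deltaHom_eq_comp n i h1 h2, ← hd']
    exact C'.map_comp _ _
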